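/- Let F_2 = ⟨x_1,x_2⟩ be free of rank 2 and let Ê_{21} ∈ Aut(F_2) be defined by x_2 ↦ x_2x_1. For any k ≠ 0, the only conjugacy classes of basis elements of F_2 that are invariant under the outer automorphism E_{21}^k are [x_1] and [x_1⁻¹]. -/

import Mathlib

/-- An element of `F_2` is a *basis element* if it belongs to some free basis,
equivalently it is the image of a generator under some automorphism. -/
def IsBasisElement (x : FreeGroup (Fin 2)) : Prop :=
  ∃ (e : MulAut (FreeGroup (Fin 2))) (i : Fin 2), e (FreeGroup.of i) = x

open Polynomial

namespace E21

abbrev Fg := FreeGroup (Fin 2)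
abbrev SLP := Matrix.SpecialLinearGroup (Fin 2) ℤ[X]

abbrev ga : Fg := FreeGroup.of 0
abbrev gb : Fg := FreeGroup.of 1

/-- induction by multiplying on the right by generators -/
theorem right_ind (Q : Fg → Prop) (h1 : Q 1)
    (ha : ∀ w, Q w → Q (w * ga)) (ha' : ∀ w, Q w → Q (w * ga⁻¹))
    (hb : ∀ w, Q w → Q (w * gb)) (hb' : ∀ w, Q w → Q (w * gb⁻¹)) (w : Fg) : Q w := by
  have key : ∀ g : Fg, ∀ w, Q w → Q (w * g) := by
    intro g
    induction g using FreeGroup.induction_on with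
    | C1 => intro w hw; simpa using hw
    | of i => 
      intro w hw
      fin_cases i
      · exact ha w hw
      · exact hb w hw
    | inv_of i _ => 
      intro w hw
      fin_cases i
      · exact ha' w hw
      · exact hb' w hw
    | mul x y hx hy => 
      intro w hw
      rw [← mul_assoc]
      exact hy _ (hx _ hw)
  simpa using key w 1 h1

/-! ### The representation -/

noncomputable def ua (n : ℤ) : SLP := ⟨!![1, C n; 0, 1], by simp [Matrix.det_fin_two]⟩
noncomputable def ub (n : ℤ) : SLP := ⟨!![1, 0; C n * X, 1], by simp [Matrix.det_fin_two]⟩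

theorem ua_mul (m n : ℤ) : ua m * ua n = ua (m + n) := by
  apply Subtype.ext
  rw [Matrix.SpecialLinearGroup.coe_mul]
  simp [ua, add_comm]

theorem ub_mul (m n : ℤ) : ub m * ub n = ub (m + n) := by
  apply Subtype.ext
  rw [Matrix.SpecialLinearGroup.coe_mul]
  simp [ub, add_mul]

theorem ua_zero : ua 0 = 1 := by
  have := ua_mul 0 0
  simpa using this
theorem ub_zero : ub 0 = 1 := by
  have := ub_mul 0 0
  simpa using this

noncomputable def rho : Fg →* SLP := FreeGroup.lift ![ua 1, ub 1]

theorem rho_a_zpow (n : ℤ) : rho (ga ^ n) = ua n := by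
  have h1 : rho ga = ua 1 := by simp [rho]
  rw [map_zpow, h1]
  induction n using Int.induction_on with
  | zero => simp [ua_zero]
  | succ i ih => rw [zpow_add_one, ih, ua_mul]
  | pred i ih => 
    rw [zpow_sub_one, ih, mul_inv_eq_iff_eq_mul, ua_mul]; simp

theorem rho_b_zpow (n : ℤ) : rho (gb ^ n) = ub n := by
  have h1 : rho gb = ub 1 := by simp [rho]
  rw [map_zpow, h1]
  induction n using Int.induction_on with
  | zero => simp [ub_zero]
  | succ i ih => rw [zpow_add_one, ih, ub_mul]
  | pred i ih => 
    rw [zpow_sub_one, ih, mul_inv_eq_iff_eq_mul, ub_mul]; simp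

theorem mul_e (A B : SLP) (i j : Fin 2) : (A * B) i j = A i 0 * B 0 j + A i 1 * B 1 j := by
  simp [Matrix.mul_apply, Fin.sum_univ_two]

theorem inv00 (A : SLP) : A⁻¹ 0 0 = A 1 1 := by
  simp [Matrix.adjugate_fin_two]
theorem inv11 (A : SLP) : A⁻¹ 1 1 = A 0 0 := by
  simp [Matrix.adjugate_fin_two]
theorem inv01 (A : SLP) : A⁻¹ 0 1 = - A 0 1 := by
  simp [Matrix.adjugate_fin_two]
theorem inv10 (A : SLP) : A⁻¹ 1 0 = - A 1 0 := by
  simp [Matrix.adjugate_fin_two]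

@[simp] theorem ua00 (n : ℤ) : ua n 0 0 = 1 := rfl
@[simp] theorem ua01 (n : ℤ) : ua n 0 1 = C n := rfl
@[simp] theorem ua10 (n : ℤ) : ua n 1 0 = 0 := rfl
@[simp] theorem ua11 (n : ℤ) : ua n 1 1 = 1 := rfl
@[simp] theorem ub00 (n : ℤ) : ub n 0 0 = 1 := rfl
@[simp] theorem ub01 (n : ℤ) : ub n 0 1 = 0 := rfl
@[simp] theorem ub10 (n : ℤ) : ub n 1 0 = C n * X := rfl
@[simp] theorem ub11 (n : ℤ) : ub n 1 1 = 1 := rfl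

noncomputable def tr (w : Fg) : ℤ[X] := rho w 0 0 + rho w 1 1

theorem tr_comm (v w : Fg) : tr (v * w) = tr (w * v) := by
  simp only [tr, map_mul, mul_e]; ring

theorem tr_conj (g w : Fg) : tr (g * w * g⁻¹) = tr w := by
  rw [tr_comm]; simp

theorem tr_rec (A B : Fg) : tr (A * B) + tr (A * B⁻¹) = tr B * tr A := by
  simp only [tr, map_mul, map_inv, mul_e, inv00, inv01, inv10, inv11]; ring

theorem rho_a : rho ga = ua 1 := by simp [rho]
theorem rho_b : rho gb = ub 1 := by simp [rho]

theorem rho_eval (w : Fg) : (rho w 0 0).eval 0 = 1 ∧ (rho w 1 1).eval 0 = 1 ∧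
    (rho w 1 0).eval 0 = 0 := by
  induction w using right_ind with
  | h1 => simp
  | ha w h | ha' w h | hb w h | hb' w h => 
    obtain ⟨h1, h2, h3⟩ := h
    simp only [map_mul, map_inv, rho_a, rho_b, mul_e, inv00, inv01, inv10, inv11]
    simp [h1, h2, h3]

theorem tr_ne (w : Fg) : tr w ≠ 0 := by
  intro h
  have h2 : (tr w).eval 0 = 2 := by
    simp [tr, rho_eval w]
  rw [h] at h2
  simp at h2

/-! ### Bounded number of b letters -/

inductive Bd : ℕ → Fg → Prop
  | one : Bd 0 1
  | a {d w} : Bd d w → Bd d (w * ga)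
  | a' {d w} : Bd d w → Bd d (w * ga⁻¹)
  | b {d w} : Bd d w → Bd (d + 1) (w * gb)
  | b' {d w} : Bd d w → Bd (d + 1) (w * gb⁻¹)

theorem exists_Bd (w : Fg) : ∃ d, Bd d w := by
  induction w using right_ind with
  | h1 => exact ⟨_, .one⟩
  | ha w h => obtain ⟨d, h⟩ := h; exact ⟨_, .a h⟩
  | ha' w h => obtain ⟨d, h⟩ := h; exact ⟨_, .a' h⟩
  | hb w h => obtain ⟨d, h⟩ := h; exact ⟨_, .b h⟩
  | hb' w h => obtain ⟨d, h⟩ := h; exact ⟨_, .b' h⟩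

theorem deg_aux1 {d : ℕ} {p q : ℤ[X]} (hp : p.natDegree ≤ d) (hq : q.natDegree ≤ d) (m : ℤ) :
    (p + C m * q).natDegree ≤ d :=
  natDegree_add_le_of_degree_le hp ((natDegree_C_mul_le _ _).trans hq)

theorem deg_aux2 {d : ℕ} {p q : ℤ[X]} (hp : p.natDegree ≤ d) (hq : q.natDegree ≤ d) (m : ℤ) :
    (p + C m * X * q).natDegree ≤ d + 1 := by
  refine natDegree_add_le_of_degree_le (by omega) ?_
  rw [mul_assoc]
  refine (natDegree_C_mul_le _ _).trans ?_
  refine natDegree_mul_le.trans ?_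
  rw [natDegree_X]; omega

theorem row_a (w : Fg) (n : ℤ) (i : Fin 2) : rho (w * ga ^ n) i 0 = rho w i 0 ∧
    rho (w * ga ^ n) i 1 = rho w i 1 + C n * rho w i 0 := by
  rw [map_mul, rho_a_zpow, mul_e, mul_e]; simp; ring

theorem row_b (w : Fg) (n : ℤ) (i : Fin 2) : rho (w * gb ^ n) i 1 = rho w i 1 ∧
    rho (w * gb ^ n) i 0 = rho w i 0 + C n * X * rho w i 1 := by
  rw [map_mul, rho_b_zpow, mul_e, mul_e]; simp; ring

theorem Bd_deg {d : ℕ} {w : Fg} (h : Bd d w) (i j : Fin 2) : (rho w i j).natDegree ≤ d := by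
  induction h generalizing j with
  | one => fin_cases i <;> fin_cases j <;> simp
  | @a d w _ ih => 
    have := row_a w 1 i
    rw [zpow_one] at this
    fin_cases j
    · simp only [Fin.zero_eta, this.1]; exact ih 0
    · simp only [Fin.mk_one, this.2]; exact deg_aux1 (ih 1) (ih 0) _
  | @a' d w _ ih => 
    have := row_a w (-1) i
    rw [zpow_neg_one] at this
    fin_cases j
    · simp only [Fin.zero_eta, this.1]; exact ih 0
    · simp only [Fin.mk_one, this.2]; exact deg_aux1 (ih 1) (ih 0) _
  | @b d w _ ih => 
    have := row_b w 1 i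
    rw [zpow_one] at this
    fin_cases j
    · simp only [Fin.zero_eta, this.2]; exact deg_aux2 (ih 0) (ih 1) _
    · simp only [Fin.mk_one, this.1]; exact (ih 1).trans (by omega)
  | @b' d w _ ih => 
    have := row_b w (-1) i
    rw [zpow_neg_one] at this
    fin_cases j
    · simp only [Fin.zero_eta, this.2]; exact deg_aux2 (ih 0) (ih 1) _
    · simp only [Fin.mk_one, this.1]; exact (ih 1).trans (by omega)

def SB (d : ℕ) (w : Fg) : Prop := ∃ g, Bd d (g * w * g⁻¹)

theorem SB_deg {d : ℕ} {w : Fg} (h : SB d w) : (tr w).natDegree ≤ d := by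
  obtain ⟨g, h⟩ := h
  rw [← tr_conj g]
  exact natDegree_add_le_of_degree_le (Bd_deg h 0 0) (Bd_deg h 1 1)

theorem SB_conj {d : ℕ} (g w : Fg) : SB d (g * w * g⁻¹) ↔ SB d w := by
  constructor
  · rintro ⟨h, hh⟩
    exact ⟨h * g, by convert hh using 1; group⟩
  · rintro ⟨h, hh⟩
    exact ⟨h * g⁻¹, by convert hh using 1; group⟩

theorem Bd_map (f : Fg →* Fg) (m : ℤ) (ha : f ga = ga)
    (hb : ∀ d w, Bd d w → Bd (d + 1) (w * f gb)) (hb' : ∀ d w, Bd d w → Bd (d + 1) (w * (f gb)⁻¹))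
    {d : ℕ} {w : Fg} (h : Bd d w) : Bd d (f w) := by
  induction h with
  | one => rw [map_one]; exact .one
  | a _ ih => rw [map_mul, ha]; exact .a ih
  | a' _ ih => rw [map_mul, map_inv, ha]; exact .a' ih
  | b _ ih => rw [map_mul]; exact hb _ _ ih
  | b' _ ih => rw [map_mul, map_inv]; exact hb' _ _ ih

theorem SB_E (E : MulAut Fg) (ha : E ga = ga) (hb : E gb = gb * ga) (d : ℕ) (w : Fg) :
    SB d w ↔ SB d (E w) := by
  have h1 : ∀ w, Bd d w → Bd d (E w) := by
    intro w hw
    refine Bd_map E.toMonoidHom 0 ha ?_ ?_ hw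
    · intro d w h
      change Bd _ (w * E gb)
      rw [hb, ← mul_assoc]; exact .a (.b h)
    · intro d w h
      change Bd _ (w * (E gb)⁻¹)
      rw [hb, mul_inv_rev, ← mul_assoc]; exact .b' (.a' h)
  have hsa : E.symm ga = ga := by rw [MulEquiv.symm_apply_eq, ha]
  have hsb : E.symm gb = gb * ga⁻¹ := by
    rw [MulEquiv.symm_apply_eq, map_mul, map_inv, ha, hb]; group
  have h2 : ∀ w, Bd d w → Bd d (E.symm w) := by
    intro w hw
    refine Bd_map E.symm.toMonoidHom 0 hsa ?_ ?_ hw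
    · intro d w h
      change Bd _ (w * E.symm gb)
      rw [hsb, ← mul_assoc]; exact .a' (.b h)
    · intro d w h
      change Bd _ (w * (E.symm gb)⁻¹)
      rw [hsb, mul_inv_rev, inv_inv, ← mul_assoc]; exact .b' (.a h)
  constructor
  · rintro ⟨g, hg⟩
    refine ⟨E g, ?_⟩
    simpa using h1 _ hg
  · rintro ⟨g, hg⟩
    refine ⟨E.symm g, ?_⟩
    simpa using h2 _ hg

theorem SB_Ek (E : MulAut Fg) (ha : E ga = ga) (hb : E gb = gb * ga) (d : ℕ) (k : ℤ) :
    ∀ w : Fg, SB d w ↔ SB d ((E ^ k) w) := by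
  let H : Subgroup (MulAut Fg) :=
    { carrier := {f | ∀ w, SB d w ↔ SB d (f w)}
      one_mem' := by intro w; rfl
      mul_mem' := by
        intro f g hf hg w
        rw [hg w, hf (g w)]; rfl
      inv_mem' := by
        intro f hf w
        rw [hf (f⁻¹ w), MulAut.apply_inv_self] }
  have hE : E ∈ H := SB_E E ha hb d
  exact H.zpow_mem hE k

/-! ### Normal forms -/

inductive NF : ℕ → Fg → Prop
  | base (e : ℤ) : e ≠ 0 → NF 1 (gb ^ e)
  | step {r w} (n e : ℤ) : n ≠ 0 → e ≠ 0 → NF r w → NF (r + 1) (w * ga ^ n * gb ^ e)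

theorem NF_mul_b {r : ℕ} {P : Fg} (h : NF r P) (f : ℤ) :
    NF r (P * gb ^ f) ∨ P * gb ^ f = 1 ∨ ∃ (r' : ℕ) (Q : Fg) (n : ℤ), NF r' Q ∧ P * gb ^ f = Q * ga ^ n := by
  cases h with
  | base e he => 
    rw [← zpow_add]
    by_cases h0 : e + f = 0
    · right; left; rw [h0, zpow_zero]
    · left; exact .base _ h0
  | @step r w n e hn he h => 
    rw [mul_assoc, ← zpow_add]
    by_cases h0 : e + f = 0
    · right; right; exact ⟨r, w, n, h, by rw [h0, zpow_zero, mul_one]⟩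
    · left; exact .step _ _ hn h0 h

def HasNF (w : Fg) : Prop := (∃ i : ℤ, w = ga ^ i) ∨
    ∃ (r : ℕ) (P : Fg) (i j : ℤ), NF r P ∧ w = ga ^ i * P * ga ^ j

theorem HasNF_a {w : Fg} (h : HasNF w) (n : ℤ) : HasNF (w * ga ^ n) := by
  rcases h with ⟨i, rfl⟩ | ⟨r, P, i, j, h, rfl⟩
  · left; exact ⟨i + n, by rw [zpow_add]⟩
  · right; exact ⟨r, P, i, j + n, h, by rw [zpow_add]; group⟩

theorem HasNF_b {w : Fg} (h : HasNF w) (n : ℤ) (hn : n ≠ 0) : HasNF (w * gb ^ n) := by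
  rcases h with ⟨i, rfl⟩ | ⟨r, P, i, j, h, rfl⟩
  · right; exact ⟨1, gb ^ n, i, 0, .base _ hn, by simp⟩
  · by_cases hj : j = 0
    · subst hj
      rw [zpow_zero, mul_one, mul_assoc]
      rcases NF_mul_b h n with h1 | h1 | ⟨r', Q, m, h1, h2⟩
      · right; exact ⟨r, _, i, 0, h1, by simp⟩
      · left; exact ⟨i, by rw [h1, mul_one]⟩
      · right; exact ⟨r', Q, i, m, h1, by rw [h2, mul_assoc]⟩
    · right; exact ⟨r + 1, _, i, 0, .step j n hj hn h, by simp [mul_assoc]⟩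

theorem hasNF (w : Fg) : HasNF w := by
  induction w using right_ind with
  | h1 => left; exact ⟨0, by simp⟩
  | ha w h => simpa using HasNF_a h 1
  | ha' w h => simpa using HasNF_a h (-1)
  | hb w h => simpa using HasNF_b h 1 (by norm_num)
  | hb' w h => simpa using HasNF_b h (-1) (by norm_num)

theorem NF_left {r : ℕ} {P : Fg} (h : NF r P) (f : ℤ) :
    NF r (gb ^ f * P) ∨ gb ^ f * P = 1 ∨
      ∃ (r' : ℕ) (Q : Fg) (n : ℤ), r' < r ∧ NF r' Q ∧ gb ^ f * P = ga ^ n * Q := by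
  induction h with
  | base e he => 
    rw [← zpow_add]
    by_cases h0 : f + e = 0
    · right; left; rw [h0, zpow_zero]
    · left; exact .base _ h0
  | @step r w n e hn he h ih => 
    rw [← mul_assoc, ← mul_assoc]
    rcases ih with h1 | h1 | ⟨r', Q, m, hr, h1, h2⟩
    · left; exact .step _ _ hn he h1
    · right; right
      have : 0 < r := by cases h <;> omega
      exact ⟨1, gb ^ e, n, by omega, .base _ he, by rw [h1, one_mul]⟩
    · right; right
      exact ⟨r' + 1, _, m, by omega, .step n e hn he h1, by rw [h2]; group⟩

def Cyc (y : Fg) : Prop := (∃ n : ℤ, IsConj y (ga ^ n)) ∨ (∃ n : ℤ, IsConj y (gb ^ n)) ∨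
    ∃ (r : ℕ) (P : Fg) (j : ℤ), NF r P ∧ j ≠ 0 ∧ IsConj y (P * ga ^ j)

theorem Cyc_conj {x y : Fg} (h : IsConj x y) (hy : Cyc y) : Cyc x := by
  rcases hy with ⟨n, hn⟩ | ⟨n, hn⟩ | ⟨r, P, j, h1, h2, h3⟩
  · exact .inl ⟨n, h.trans hn⟩
  · exact .inr (.inl ⟨n, h.trans hn⟩)
  · exact .inr (.inr ⟨r, P, j, h1, h2, h.trans h3⟩)

theorem conj_comm (x y : Fg) : IsConj (x * y) (y * x) :=
  isConj_iff.2 ⟨y, by group⟩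

theorem cyc_NF (r : ℕ) : ∀ P, NF r P → ∀ j : ℤ, Cyc (P * ga ^ j) := by
  induction r using Nat.strong_induction_on with
  | _ r ih => 
    intro P hP j
    by_cases hj : j = 0
    · subst hj
      rw [zpow_zero, mul_one]
      cases hP with
      | base e he => exact .inr (.inl ⟨e, IsConj.refl _⟩)
      | @step r w n e hn he h => 
        refine Cyc_conj (conj_comm _ _) ?_
        rw [← mul_assoc]
        rcases NF_left h e with h1 | h1 | ⟨r', Q, m, hr, h1, h2⟩
        · exact ih r (by omega) _ h1 n
        · rw [h1, one_mul]; exact .inl ⟨n, IsConj.refl _⟩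
        · rw [h2, mul_assoc]
          refine Cyc_conj (conj_comm _ _) ?_
          rw [mul_assoc, ← zpow_add]
          exact ih r' (by omega) _ h1 _
    · exact .inr (.inr ⟨r, P, j, hP, hj, IsConj.refl _⟩)

theorem cyc (y : Fg) : Cyc y := by
  rcases hasNF y with ⟨i, rfl⟩ | ⟨r, P, i, j, h, rfl⟩
  · exact .inl ⟨i, IsConj.refl _⟩
  · rw [mul_assoc]
    refine Cyc_conj (conj_comm _ _) ?_
    rw [mul_assoc, ← zpow_add]
    exact cyc_NF r P h _

theorem NF_deg {r : ℕ} {P : Fg} (h : NF r P) : 1 ≤ r ∧ (rho P 1 0).natDegree = r ∧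
    (rho P 1 1).natDegree < r ∧ (rho P 0 0).natDegree < r ∧ (rho P 0 1).natDegree < r := by
  induction h with
  | base e he => 
    rw [rho_b_zpow]
    simp only [ub10, ub11, ub00, ub01, natDegree_C_mul_X e he]
    simp
  | @step r w n e hn he h ih => 
    obtain ⟨h1, h10, h11, h00, h01⟩ := ih
    have q1 : (rho w 1 1 + C n * rho w 1 0).natDegree = r := by
      rw [natDegree_add_eq_right_of_natDegree_lt]
      · rw [natDegree_C_mul hn, h10]
      · rw [natDegree_C_mul hn, h10]; exact h11
    have q0 : (rho w 0 1 + C n * rho w 0 0).natDegree ≤ r - 1 :=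
      deg_aux1 (by omega) (by omega) _
    refine ⟨by omega, ?_, ?_, ?_, ?_⟩
    · rw [(row_b _ _ _).2, (row_a _ _ _).1, (row_a _ _ _).2]
      have q2 : (C e * X * (rho w 1 1 + C n * rho w 1 0)).natDegree = r + 1 := by
        rw [mul_assoc, natDegree_C_mul he, natDegree_X_mul, q1]
        intro h0
        rw [h0] at q1
        simp at q1
        omega
      rw [natDegree_add_eq_right_of_natDegree_lt, q2]
      rw [q2, h10]; omega
    · rw [(row_b _ _ _).1, (row_a _ _ _).2, q1]; omega
    · rw [(row_b _ _ _).2, (row_a _ _ _).1, (row_a _ _ _).2]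
      have := deg_aux2 (d := r - 1) (p := rho w 0 0) (by omega) q0 e
      omega
    · rw [(row_b _ _ _).1, (row_a _ _ _).2]; omega

theorem NF_tr {r : ℕ} {P : Fg} (h : NF r P) (j : ℤ) (hj : j ≠ 0) :
    1 ≤ (tr (P * ga ^ j)).natDegree := by
  obtain ⟨h1, h10, h11, h00, h01⟩ := NF_deg h
  rw [tr, (row_a _ _ _).1, (row_a _ _ _).2, ← add_assoc,
    natDegree_add_eq_right_of_natDegree_lt]
  · rw [natDegree_C_mul hj, h10]; exact h1
  · rw [natDegree_C_mul hj, h10]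
    have := natDegree_add_le (rho P 0 0) (rho P 1 1)
    omega

/-! ### automorphisms fixing `a` -/

theorem fix_a (ψ : MulAut Fg) (ha : ψ ga = ga) :
    ∃ i j e : ℤ, (e = 1 ∨ e = -1) ∧ ψ gb = ga ^ i * gb ^ e * ga ^ j := by
  have hdiv : ∀ w, rho (ψ gb) 1 0 ∣ rho (ψ w) 1 0 := by
    intro w
    induction w using right_ind with
    | h1 => simp
    | ha w h | ha' w h | hb w h | hb' w h => 
      simp only [map_mul, map_inv, ha, rho_a, mul_e, inv00, inv01, inv10, inv11]
      simp [dvd_add, Dvd.dvd.mul_right, h]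
  have hX : rho (ψ gb) 1 0 ∣ X := by
    have := hdiv (ψ⁻¹ gb)
    rw [MulAut.apply_inv_self] at this
    simpa [rho_b] using this
  rcases hasNF (ψ gb) with ⟨i, hi⟩ | ⟨r, P, i, j, h, hi⟩
  · rw [hi, rho_a_zpow] at hX
    simp at hX
  · have h10 : rho (ψ gb) 1 0 = rho P 1 0 := by
      rw [hi, (row_a _ _ _).1, map_mul, rho_a_zpow, mul_e]; simp
    rw [h10] at hX
    have hd := NF_deg h
    have hle := natDegree_le_of_dvd hX X_ne_zero
    rw [hd.2.1, natDegree_X] at hle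
    cases h with
    | base e he => 
      refine ⟨i, j, e, ?_, hi⟩
      rw [rho_b_zpow, ub10] at hX
      obtain ⟨q, hq⟩ := hX
      have h3 := congrArg (fun p => coeff p 1) hq
      simp only [coeff_X_one, mul_assoc, coeff_C_mul] at h3
      exact Int.isUnit_iff.1 (IsUnit.of_mul_eq_one _ h3.symm)
    | @step r w n e hn he h => 
      have := (NF_deg h).1
      omega

/-! ### abelianization -/

noncomputable def chi (u v : ℤ) : Fg →* Multiplicative ℤ :=
  FreeGroup.lift ![Multiplicative.ofAdd u, Multiplicative.ofAdd v]

noncomputable def xa (w : Fg) : ℤ := (chi 1 0 w).toAdd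
noncomputable def xb (w : Fg) : ℤ := (chi 0 1 w).toAdd

@[simp] theorem xa_mul (v w : Fg) : xa (v * w) = xa v + xa w := by simp [xa]
@[simp] theorem xb_mul (v w : Fg) : xb (v * w) = xb v + xb w := by simp [xb]
@[simp] theorem xa_inv (v : Fg) : xa v⁻¹ = - xa v := by simp [xa]
@[simp] theorem xb_inv (v : Fg) : xb v⁻¹ = - xb v := by simp [xb]
@[simp] theorem xa_one : xa 1 = 0 := by simp [xa]
@[simp] theorem xb_one : xb 1 = 0 := by simp [xb]
@[simp] theorem xa_zpow (v : Fg) (n : ℤ) : xa (v ^ n) = n * xa v := by simp [xa]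
@[simp] theorem xb_zpow (v : Fg) (n : ℤ) : xb (v ^ n) = n * xb v := by simp [xb]
@[simp] theorem xa_a : xa ga = 1 := by simp [xa, chi]
@[simp] theorem xb_a : xb ga = 0 := by simp [xb, chi]
@[simp] theorem xa_b : xa gb = 0 := by simp [xa, chi]
@[simp] theorem xb_b : xb gb = 1 := by simp [xb, chi]

theorem xa_conj {v w : Fg} (h : IsConj v w) : xa v = xa w := by
  obtain ⟨c, rfl⟩ := isConj_iff.1 h
  simp
theorem xb_conj {v w : Fg} (h : IsConj v w) : xb v = xb w := by
  obtain ⟨c, rfl⟩ := isConj_iff.1 h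
  simp

theorem x_Ek (E : MulAut Fg) (ha : E ga = ga) (hb : E gb = gb * ga) (k : ℤ) :
    ∀ w, xb ((E ^ k) w) = xb w ∧ xa ((E ^ k) w) = xa w + k * xb w := by
  have h1 : ∀ w, xb (E w) = xb w ∧ xa (E w) = xa w + xb w := by
    intro w
    induction w using right_ind with
    | h1 => simp
    | ha w h | ha' w h | hb w h | hb' w h => 
      constructor <;> simp [ha, hb, h] <;> ring
  induction k using Int.induction_on with
  | zero => simp
  | succ i ih => 
    intro w
    rw [zpow_add_one, MulAut.mul_apply]
    have := ih (E w)
    rw [this.1, this.2, (h1 w).1, (h1 w).2]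
    refine ⟨rfl, by ring⟩
  | pred i ih => 
    intro w
    rw [zpow_sub_one, MulAut.mul_apply]
    have := ih (E⁻¹ w)
    have h2 := h1 (E⁻¹ w)
    rw [MulAut.apply_inv_self] at h2
    rw [this.1, this.2, h2.1, h2.2]
    refine ⟨rfl, by ring⟩

/-! ### growth -/

theorem growth (t y : Fg) (D : ℕ) (hD : ∀ M : ℤ, (tr (t * y ^ M)).natDegree ≤ D)
    (hy : 1 ≤ (tr y).natDegree) : False := by
  have key : ∀ k : ℕ, ∀ M : ℤ, (tr (t * y ^ M)).natDegree + k ≤ D := by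
    intro k
    induction k with
    | zero => exact hD
    | succ k ih => 
      intro M
      have h := tr_rec (t * y ^ M) y
      have e1 : t * y ^ M * y = t * y ^ (M + 1) := by rw [zpow_add_one, mul_assoc]
      have e2 : t * y ^ M * y⁻¹ = t * y ^ (M - 1) := by rw [zpow_sub_one, mul_assoc]
      rw [e1, e2] at h
      have h2 := congrArg natDegree h
      rw [natDegree_mul (tr_ne _) (tr_ne _)] at h2
      have h3 := natDegree_add_le (tr (t * y ^ (M + 1))) (tr (t * y ^ (M - 1)))
      have := ih (M + 1)
      have := ih (M - 1)
      omega
  have := key (D + 1) 0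
  omega

theorem bounded (φ : MulAut Fg) (hφ : ∀ d w, SB d w ↔ SB d (φ w)) (t y : Fg) (i j : ℤ)
    (hy : φ y = y) (ht : φ t = y ^ i * t * y ^ j) (hij : i + j ≠ 0) :
    ∃ D : ℕ, ∀ M : ℤ, (tr (t * y ^ M)).natDegree ≤ D := by
  have step : ∀ d (M : ℤ), SB d (t * y ^ M) ↔ SB d (t * y ^ (M + (i + j))) := by
    intro d M
    rw [hφ, ← SB_conj (y ^ (-i))]
    have : y ^ (-i) * φ (t * y ^ M) * (y ^ (-i))⁻¹ = t * y ^ (M + (i + j)) := by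
      rw [map_mul, map_zpow, hy, ht]
      have : y ^ (M + (i + j)) = y ^ j * y ^ M * y ^ i := by
        rw [← zpow_add, ← zpow_add]; congr 1; ring
      rw [this]; group
    rw [this]
  have steps : ∀ d (q M : ℤ), SB d (t * y ^ M) ↔ SB d (t * y ^ (M + q * (i + j))) := by
    intro d q M
    induction q using Int.induction_on with
    | zero => simp
    | succ n ih => 
      rw [ih, step]
      have : M + (n : ℤ) * (i + j) + (i + j) = M + ((n : ℤ) + 1) * (i + j) := by ring
      rw [this]
    | pred n ih => 
      rw [ih, step d (M + (-(n : ℤ) - 1) * (i + j))]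
      have : M + (-(n : ℤ) - 1) * (i + j) + (i + j) = M + (-(n : ℤ)) * (i + j) := by ring
      rw [this]
  have ex : ∀ M : ℤ, ∃ d, SB d (t * y ^ M) := by
    intro M
    obtain ⟨d, hd⟩ := exists_Bd (t * y ^ M)
    exact ⟨d, 1, by simpa using hd⟩
  choose d hd using ex
  refine ⟨(Finset.Ico 0 |i + j|).sup d, fun M => ?_⟩
  have hs := (steps (d (M % (i + j))) (M / (i + j)) (M % (i + j))).1 (hd _)
  rw [mul_comm (M / (i + j)), Int.emod_add_mul_ediv] at hs
  refine (SB_deg hs).trans ?_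
  refine Finset.le_sup (f := d) ?_
  rw [Finset.mem_Ico]
  exact ⟨Int.emod_nonneg _ hij, Int.emod_lt_abs _ hij⟩

theorem main (E : MulAut Fg) (ha : E ga = ga) (hb : E gb = gb * ga) (k : ℤ) (hk : k ≠ 0)
    (e : MulAut Fg) (h : IsConj (e ga) ((E ^ k) (e ga))) :
    IsConj (e ga) ga ∨ IsConj (e ga) ga⁻¹ := by
  have hyb : xb (e ga) = 0 := by
    have h1 := xa_conj h
    rw [(x_Ek E ha hb k _).2] at h1
    have : k * xb (e ga) = 0 := by linarith
    simpa [hk] using this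
  have hpow : ∀ n : ℤ, IsConj (e ga) (ga ^ n) → IsConj (e ga) ga ∨ IsConj (e ga) ga⁻¹ := by
    intro n hn
    have h1 : IsConj ga ((e⁻¹ ga) ^ n) := by
      have := (e⁻¹ : MulAut Fg).toMonoidHom.map_isConj hn
      simpa using this
    have h2 := xa_conj h1
    rw [xa_a, xa_zpow] at h2
    rcases Int.isUnit_iff.1 (IsUnit.of_mul_eq_one _ h2.symm) with rfl | rfl
    · left; simpa using hn
    · right; simpa using hn
  rcases cyc (e ga) with ⟨n, hn⟩ | ⟨n, hn⟩ | ⟨r, P, j, hP, hj, hc⟩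
  · exact hpow n hn
  · have := xb_conj hn
    rw [hyb, xb_zpow, xb_b, mul_one] at this
    subst this
    exact hpow 0 (by simpa using hn)
  · exfalso
    have hdeg : 1 ≤ (tr (e ga)).natDegree := by
      obtain ⟨c, hc⟩ := isConj_iff.1 hc
      rw [← tr_conj c, hc]
      exact NF_tr hP j hj
    obtain ⟨g, hg⟩ := isConj_iff.1 h.symm
    let φ : MulAut Fg := MulAut.conj g * E ^ k
    have hφ : ∀ w, φ w = g * (E ^ k) w * g⁻¹ := fun w => rfl
    have hφy : φ (e ga) = e ga := hg
    obtain ⟨i, j, ε, hε, hb'⟩ := fix_a (e⁻¹ * φ * e) (by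
      change e⁻¹ (φ (e ga)) = ga
      rw [hφy, MulAut.inv_apply_self])
    have ht : φ (e gb) = (e ga) ^ i * (e gb) ^ ε * (e ga) ^ j := by
      have := congrArg e hb'
      change e (e⁻¹ (φ (e gb))) = _ at this
      rw [MulAut.apply_inv_self] at this
      simpa using this
    have hxb : ∀ w, xb (φ w) = xb w := by
      intro w; rw [hφ]; simp [(x_Ek E ha hb k w).1]
    have hxa : ∀ w, xa (φ w) = xa w + k * xb w := by
      intro w; rw [hφ]; simp [(x_Ek E ha hb k w).2]
    have htb : xb (e gb) ≠ 0 := by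
      intro h0
      have h1 : ∀ w, xb (e w) = 0 := by
        intro w
        induction w using right_ind with
        | h1 => simp
        | ha w h | ha' w h | hb w h | hb' w h => simp [h, h0, hyb]
      have := h1 (e⁻¹ gb)
      rw [MulAut.apply_inv_self] at this
      simp at this
    have hε1 : ε = 1 := by
      have h1 := hxb (e gb)
      rw [ht] at h1
      simp only [xb_mul, xb_zpow, hyb, mul_zero, zero_add, add_zero] at h1
      exact mul_right_cancel₀ htb (by rw [h1, one_mul])
    subst hε1
    have hij : i + j ≠ 0 := by
      intro h0
      have h1 := hxa (e gb)
      rw [ht] at h1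
      simp at h1
      have h2 : k * xb (e gb) = (i + j) * xa (e ga) := by linarith
      rw [h0, zero_mul] at h2
      exact (mul_ne_zero hk htb) h2
    rw [zpow_one] at ht
    obtain ⟨D, hD⟩ := bounded φ (by
      intro d w
      rw [hφ, SB_conj]
      exact SB_Ek E ha hb d k w) (e gb) (e ga) i j hφy ht hij
    exact growth _ _ D hD hdeg

end E21

/-- With `Ê_{21} : x_2 ↦ x_2x_1` in `Aut(F_2)` and `k ≠ 0`, the only conjugacy
classes of basis elements of `F_2` invariant under `E_{21}^k` are `[x_1]` and
`[x_1⁻¹]`. -/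
theorem E21_invariant_basis_classes (E : MulAut (FreeGroup (Fin 2)))
    (hE : ∀ i : Fin 2, E (FreeGroup.of i) =
      if i = 1 then FreeGroup.of 1 * FreeGroup.of 0 else FreeGroup.of i)
    (k : ℤ) (hk : k ≠ 0) (y : FreeGroup (Fin 2)) (hy : IsBasisElement y) :
    IsConj y ((E ^ k) y) ↔
      (IsConj y (FreeGroup.of (0 : Fin 2)) ∨ IsConj y (FreeGroup.of (0 : Fin 2))⁻¹) := by
  have ha : E E21.ga = E21.ga := by simpa using hE 0
  have hb : E E21.gb = E21.gb * E21.ga := by simpa using hE 1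
  constructor
  · intro h
    obtain ⟨e, i, rfl⟩ := hy
    fin_cases i
    · exact E21.main E ha hb k hk e h
    · have hs : (e * (FreeGroup.freeGroupCongr (Equiv.swap 0 1) : MulAut E21.Fg)) E21.ga
          = e E21.gb := by
        rw [MulAut.mul_apply]
        congr 1
      have := E21.main E ha hb k hk
        (e * (FreeGroup.freeGroupCongr (Equiv.swap 0 1) : MulAut E21.Fg))
      rw [hs] at this
      exact this h
  · have hfix : (E ^ k) E21.ga = E21.ga := by
      let H : Subgroup (MulAut E21.Fg) := MulAction.stabilizer (MulAut E21.Fg) E21.ga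
      have hE : E ∈ H := ha
      exact H.zpow_mem hE k
    rintro (h | h)
    · have h2 := (E ^ k).toMonoidHom.map_isConj h
      change IsConj ((E ^ k) y) ((E ^ k) E21.ga) at h2
      rw [hfix] at h2
      exact h.trans h2.symm
    · have h2 := (E ^ k).toMonoidHom.map_isConj h
      change IsConj ((E ^ k) y) ((E ^ k) E21.ga⁻¹) at h2
      rw [map_inv, hfix] at h2
      exact h.trans h2.symm
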